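/- Let A' be an integer array of length n, and say that an array B of length n+1 is consistent with A' if there exists a word w of length n+1 (over the alphabet ℕ) such that B = π_w and π'_w[j] = A'[j] for all 1 ≤ j ≤ n. Suppose A of length n+1 is consistent with A' and maximal, i.e., for every B consistent with A' one has B[j] ≤ A[j] for all 1 ≤ j ≤ n+1. Let i be the first position of the last slope of A, i.e., the least index i such that A[j+1] = A[j] + 1 for all i ≤ j ≤ n. Then every B consistent with A' satisfies B[j] = A[j] for all 1 ≤ j ≤ i−1. -/

import Mathlib

/- A word over alphabet `α` is modelled as `w : ℕ → α`, indexed `w 1, …, w n`. -/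

/-- `IsBorder w i b`: `b` is the length of a border (possibly non-proper) of the
prefix `w[1..i]`, i.e. `b ≤ i` and `w[1..b] = w[i-b+1..i]`. -/
def IsBorder {α : Type*} (w : ℕ → α) (i b : ℕ) : Prop :=
  b ≤ i ∧ ∀ t, 1 ≤ t → t ≤ b → w t = w (i - b + t)

/-- The failure function (border array) `π_w[i]`: the length of the longest proper
border of `w[1..i]`. -/
noncomputable def piF {α : Type*} (w : ℕ → α) (i : ℕ) : ℕ :=
  sSup {b | b < i ∧ IsBorder w i b}

/- The strong failure function `π'_w[i]` of a word of length `n`, valued in `ℤ`: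
`π'_w[n] = π_w[n]`, and for `i < n` the length of the longest proper border `b` of
`w[1..i]` with `w[b+1] ≠ w[i+1]`, or `-1` if no such border exists. -/
open Classical in
noncomputable def piF' {α : Type*} (w : ℕ → α) (n i : ℕ) : ℤ :=
  if i = n then (piF w i : ℤ)
  else if ({b | b < i ∧ IsBorder w i b ∧ w (b + 1) ≠ w (i + 1)} : Set ℕ).Nonempty
    then ((sSup {b | b < i ∧ IsBorder w i b ∧ w (b + 1) ≠ w (i + 1)} : ℕ) : ℤ)
    else -1

/-- An array `B[1..n+1]` is consistent with `A'[1..n]` if there is a word `w` of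
length `n+1` over the alphabet `ℕ` with `B = π_w` on `[1..n+1]` and `π'_w = A'` on `[1..n]`. -/
def Consistent (n : ℕ) (A' : ℕ → ℤ) (B : ℕ → ℕ) : Prop :=
  ∃ w : ℕ → ℕ, (∀ j, 1 ≤ j → j ≤ n + 1 → B j = piF w j) ∧
    (∀ j, 1 ≤ j → j ≤ n → piF' w (n + 1) j = A' j)

theorem bddAbove_setOf_lt_and (i : ℕ) (P : ℕ → Prop) : BddAbove {b | b < i ∧ P b} :=
  ⟨i, fun _ hb => hb.1.le⟩

theorem IsBorder.le_piF {α : Type*} {w : ℕ → α} {i b : ℕ} (h : IsBorder w i b) (hb : b < i) :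
    b ≤ piF w i :=
  le_csSup (bddAbove_setOf_lt_and i _) ⟨hb, h⟩

theorem piF_lt_and_isBorder {α : Type*} (w : ℕ → α) {i : ℕ} (hi : 1 ≤ i) :
    piF w i < i ∧ IsBorder w i (piF w i) :=
  Nat.sSup_mem (s := {b | b < i ∧ IsBorder w i b})
    ⟨0, by omega, by omega, fun t h1 h2 => by omega⟩ (bddAbove_setOf_lt_and i _)

theorem IsBorder.of_succ {α : Type*} {w : ℕ → α} {i b : ℕ} (h : IsBorder w (i + 1) (b + 1)) :
    IsBorder w i b := by
  refine ⟨by have := h.1; omega, fun t h1 h2 => ?_⟩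
  have := h.2 t h1 (by omega)
  rwa [Nat.add_sub_add_right] at this

theorem IsBorder.succ {α : Type*} {w : ℕ → α} {i b : ℕ} (h : IsBorder w i b)
    (hw : w (b + 1) = w (i + 1)) : IsBorder w (i + 1) (b + 1) := by
  obtain ⟨hle, h⟩ := h
  refine ⟨by omega, fun t h1 h2 => ?_⟩
  rw [Nat.add_sub_add_right]
  rcases Nat.lt_or_ge b t with hbt | hbt
  · obtain rfl : t = b + 1 := by omega
    rw [hw]
    congr 1
    omega
  · exact h t h1 hbt

theorem piF_succ_le {α : Type*} (w : ℕ → α) (i : ℕ) : piF w (i + 1) ≤ piF w i + 1 := by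
  obtain ⟨hlt, hb⟩ := piF_lt_and_isBorder w (Nat.succ_pos i)
  rcases hc : piF w (i + 1) with _ | c
  · omega
  · rw [Nat.succ_eq_add_one, hc] at hlt hb
    have := hb.of_succ.le_piF (by omega)
    omega

theorem piF'_le_piF {α : Type*} (w : ℕ → α) (n i : ℕ) : piF' w n i ≤ piF w i := by
  unfold piF'
  split_ifs with h1 h2
  · exact le_rfl
  · have h := Nat.sSup_mem h2 (bddAbove_setOf_lt_and i _)
    exact_mod_cast h.2.1.le_piF h.1
  · omega

theorem piF_le_piF'_of_piF_succ_ne {α : Type*} (w : ℕ → α) (n : ℕ) {i : ℕ} (hi : 1 ≤ i)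
    (hne : piF w (i + 1) ≠ piF w i + 1) : (piF w i : ℤ) ≤ piF' w n i := by
  obtain ⟨hlt, hb⟩ := piF_lt_and_isBorder w hi
  have hw : w (piF w i + 1) ≠ w (i + 1) := fun hw =>
    hne (le_antisymm (piF_succ_le w i) ((hb.succ hw).le_piF (by omega)))
  have hmem : piF w i ∈ {b | b < i ∧ IsBorder w i b ∧ w (b + 1) ≠ w (i + 1)} := ⟨hlt, hb, hw⟩
  unfold piF'
  split_ifs with h1 h2
  · exact le_rfl
  · exact_mod_cast le_csSup (bddAbove_setOf_lt_and i _) hmem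
  · exact absurd ⟨_, hmem⟩ h2

theorem Consistent.le_of_succ_ne {n : ℕ} {A' : ℕ → ℤ} {A B : ℕ → ℕ} (hA : Consistent n A' A)
    (hB : Consistent n A' B) {j : ℕ} (h1 : 1 ≤ j) (hn : j ≤ n) (hne : A (j + 1) ≠ A j + 1) :
    A j ≤ B j := by
  obtain ⟨v, hv, hv'⟩ := hA
  obtain ⟨w, hw, hw'⟩ := hB
  rw [hv j h1 (by omega), hv (j + 1) (by omega) (by omega)] at hne
  have h := piF_le_piF'_of_piF_succ_ne v (n + 1) h1 hne
  rw [hv' j h1 hn, ← hw' j h1 hn] at h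
  rw [hv j h1 (by omega), hw j h1 (by omega)]
  exact_mod_cast h.trans (piF'_le_piF w (n + 1) j)

theorem Consistent.succ_le {n : ℕ} {A' : ℕ → ℤ} {B : ℕ → ℕ} (hB : Consistent n A' B) {j : ℕ}
    (h1 : 1 ≤ j) (hn : j ≤ n) : B (j + 1) ≤ B j + 1 := by
  obtain ⟨w, hw, -⟩ := hB
  rw [hw j h1 (by omega), hw (j + 1) (by omega) (by omega)]
  exact piF_succ_le w j

/-- If `A[1..n+1]` is a maximal function consistent with `A'[1..n]` and `i` is the
first position of the last slope of `A`, then every `B` consistent with `A'` agrees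
with `A` on `[1..i-1]`. -/
theorem maximal_consistent_prefix_determined (n : ℕ) (A' : ℕ → ℤ) (A : ℕ → ℕ) (i : ℕ)
    (hA : Consistent n A' A)
    (hmax : ∀ B : ℕ → ℕ, Consistent n A' B → ∀ j, 1 ≤ j → j ≤ n + 1 → B j ≤ A j)
    (hi1 : 1 ≤ i)
    (hslope : ∀ j, i ≤ j → j ≤ n → A (j + 1) = A j + 1)
    (hleast : ∀ i', 1 ≤ i' → (∀ j, i' ≤ j → j ≤ n → A (j + 1) = A j + 1) → i ≤ i') :
    ∀ B : ℕ → ℕ, Consistent n A' B → ∀ j, 1 ≤ j → j ≤ i - 1 → B j = A j := by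
  intro B hB j hj1 hji
  have hin : i ≤ n + 1 := hleast (n + 1) (by omega) fun j _ _ => by omega
  induction hji using Nat.decreasingInduction with
  | self =>
    refine le_antisymm (hmax B hB _ hj1 (by omega)) (hA.le_of_succ_ne hB hj1 (by omega) ?_)
    intro hstep
    have := hleast (i - 1) hj1 fun k hk hkn => by
      rcases Nat.lt_or_ge k i with hki | hki
      · obtain rfl : k = i - 1 := by omega
        exact hstep
      · exact hslope k hki hkn
    omega
  | of_succ k hk ih =>
    have hkA := hmax B hB k hj1 (by omega)
    by_contra hne
    have hsucc := ih (by omega)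
    have hBk := hB.succ_le hj1 (by omega)
    have := hA.le_of_succ_ne hB hj1 (by omega) (by omega)
    omega
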